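/- arXiv:2005.05694 — 3 statements merged into one kernel-verified Lean document; each statement's English description precedes it below -/
import Mathlib

section
/- Let M be a finite-dimensional L-vector space, φ : M → M a bijective σ-semilinear map, and N : M → M an L-linear map satisfying N ∘ φ = p · (φ ∘ N) (i.e. N(φ(x)) = p·φ(N(x)) for all x ∈ M). Then N is nilpotent. -/
open Polynomial

theorem Matrix.charpoly_smul_comp {R n : Type*} [CommRing R] [Fintype n] [DecidableEq n]
    (c : R) (A : Matrix n n R) :
    (c • A).charpoly.comp (C c * X) = C c ^ Fintype.card n * A.charpoly := by
  rw [Matrix.charpoly, Matrix.charpoly, ← Matrix.det_smul, ← coe_compRingHom_apply,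
    RingHom.map_det]
  congr 1
  ext1 i j
  by_cases h : i = j
  · subst h
    simp [mul_sub]
  · simp [h]

theorem Matrix.pow_mul_coeff_charpoly_smul {R n : Type*} [CommRing R] [Fintype n] [DecidableEq n]
    (c : R) (A : Matrix n n R) (i : ℕ) :
    (c • A).charpoly.coeff i * c ^ i = c ^ Fintype.card n * A.charpoly.coeff i := by
  rw [← comp_C_mul_X_coeff, Matrix.charpoly_smul_comp, ← C_pow, coeff_C_mul]

theorem WittVector.eq_zero_of_eq_pow_mul_map_frobenius {p : ℕ} [Fact p.Prime]
    {k : Type*} [Field k] [CharP k p] [PerfectRing k p]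
    {L : Type*} [Field L] [Algebra (WittVector p k) L] [IsFractionRing (WittVector p k) L]
    {σ : L →+* L}
    (hσ : ∀ x : WittVector p k,
      σ (algebraMap (WittVector p k) L x) = algebraMap (WittVector p k) L (WittVector.frobenius x))
    {a : L} {i : ℕ} (hi : i ≠ 0) (ha : a = (p : L) ^ i * σ a) : a = 0 := by
  by_contra h0
  obtain ⟨x, y, hy, rfl⟩ := IsFractionRing.div_surjective (A := WittVector p k) a
  have hy0 : y ≠ 0 := nonZeroDivisors.ne_zero hy
  have hx0 : x ≠ 0 := by
    rintro rfl
    simp at h0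
  obtain ⟨m, u, rfl⟩ := WittVector.exists_eq_pow_p_mul' x hx0
  obtain ⟨n, w, rfl⟩ := WittVector.exists_eq_pow_p_mul' y hy0
  have hp : (p : WittVector p k) ≠ 0 := WittVector.p_nonzero p k
  have hinj : Function.Injective (algebraMap (WittVector p k) L) := IsFractionRing.injective _ _
  have hFy : WittVector.frobenius ((p : WittVector p k) ^ n * (w : WittVector p k)) ≠ 0 := by
    rw [map_ne_zero_iff _ (WittVector.frobenius_bijective p k).injective]
    exact hy0
  rw [map_div₀, hσ, hσ, ← mul_div_assoc, div_eq_div_iff (by rwa [map_ne_zero_iff _ hinj])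
    (by rwa [map_ne_zero_iff _ hinj]), ← map_natCast (algebraMap (WittVector p k) L) p, ← map_pow,
    ← map_mul, ← map_mul, ← map_mul] at ha
  have h := hinj ha
  simp only [map_mul, map_pow, map_natCast] at h
  have h' : (u : WittVector p k) * WittVector.frobenius (w : WittVector p k) =
      (p : WittVector p k) ^ i * (WittVector.frobenius (u : WittVector p k) * w) := by
    apply mul_left_cancel₀ (pow_ne_zero (m + n) hp)
    linear_combination h
  refine (WittVector.irreducible p (k := k)).not_isUnit (isUnit_of_dvd_unit ?_
    (u.isUnit.mul (w.isUnit.map WittVector.frobenius)))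
  rw [h']
  exact (dvd_pow_self _ hi).mul_right _

/-- The image of a basis under a bijective semilinear map. -/
noncomputable def Module.Basis.mapSemilinear {L M ι : Type*} [Field L] [AddCommGroup M]
    [Module L M] [FiniteDimensional L M] [Fintype ι] (b : Module.Basis ι L M) {σ : L ≃+* L}
    (φ : M →ₛₗ[(σ : L →+* L)] M) (hφ : Function.Injective φ) : Module.Basis ι L M :=
  basisOfLinearIndependentOfCardEqFinrank' (φ ∘ b)
    (b.linearIndependent.map_of_injective_injective σ.symm φ.toAddMonoidHom (by simp)
      (fun m hm ↦ (map_eq_zero_iff φ hφ).1 hm) (by simp))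
    (Module.finrank_eq_card_basis b).symm

theorem Module.Basis.mapSemilinear_apply {L M ι : Type*} [Field L] [AddCommGroup M]
    [Module L M] [FiniteDimensional L M] [Fintype ι] (b : Module.Basis ι L M) {σ : L ≃+* L}
    (φ : M →ₛₗ[(σ : L →+* L)] M) (hφ : Function.Injective φ) (i : ι) :
    b.mapSemilinear φ hφ i = φ (b i) :=
  congrFun (coe_basisOfLinearIndependentOfCardEqFinrank' (φ ∘ b) _ _) i

theorem LinearMap.toMatrix_mapSemilinear {L M ι : Type*} [Field L] [AddCommGroup M]
    [Module L M] [FiniteDimensional L M] [Fintype ι] [DecidableEq ι] (b : Module.Basis ι L M)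
    {σ : L ≃+* L} (φ : M →ₛₗ[(σ : L →+* L)] M) (hφ : Function.Injective φ)
    (N : M →ₗ[L] M) (c : L) (hN : ∀ x : M, N (φ x) = c • φ (N x)) :
    LinearMap.toMatrix (b.mapSemilinear φ hφ) (b.mapSemilinear φ hφ) N =
      c • (LinearMap.toMatrix b b N).map σ := by
  apply (Matrix.toLin (b.mapSemilinear φ hφ) (b.mapSemilinear φ hφ)).injective
  rw [Matrix.toLin_toMatrix]
  refine (b.mapSemilinear φ hφ).ext fun j ↦ ?_
  rw [map_smul, LinearMap.smul_apply, Matrix.toLin_self, b.mapSemilinear_apply, hN,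
    ← b.sum_repr (N (b j)), map_sum]
  simp [LinearMap.toMatrix_apply, Module.Basis.mapSemilinear_apply, map_smulₛₗ]


/-- Let `p` be a prime, `k` a perfect field of characteristic `p`,
`L` the fraction field of the ring of Witt vectors `W(k)`, and `σ : L ≃+* L` the field
automorphism induced by the Witt-vector Frobenius.  If `M` is a finite-dimensional
`L`-vector space, `φ : M → M` a bijective `σ`-semilinear map and `N : M → M` an
`L`-linear map satisfying `N (φ x) = p • φ (N x)` for all `x`, then `N` is nilpotent. -/
theorem statement0 (p : ℕ) [Fact p.Prime]
    (k : Type*) [Field k] [CharP k p] [PerfectField k]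
    (L : Type*) [Field L] [Algebra (WittVector p k) L] [IsFractionRing (WittVector p k) L]
    (σ : L ≃+* L)
    (hσ : ∀ x : WittVector p k,
      σ (algebraMap (WittVector p k) L x) = algebraMap (WittVector p k) L (WittVector.frobenius x))
    (M : Type*) [AddCommGroup M] [Module L M] [FiniteDimensional L M]
    (φ : M →ₛₗ[(σ : L →+* L)] M) (hφ : Function.Bijective φ)
    (N : M →ₗ[L] M)
    (hN : ∀ x : M, N (φ x) = (p : L) • φ (N x)) :
    IsNilpotent N := by
  have : PerfectRing k p := PerfectField.toPerfectRing p
  let b := Module.finBasis L M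
  rw [LinearMap.isNilpotent_iff_charpoly]
  ext i
  rw [coeff_X_pow]
  rcases lt_trichotomy i (Module.finrank L M) with hi | rfl | hi
  · rw [if_neg hi.ne]
    obtain ⟨d, hd⟩ := Nat.exists_eq_add_of_lt hi
    have hp : (p : L) ≠ 0 := by
      rw [← map_natCast (algebraMap (WittVector p k) L) p,
        map_ne_zero_iff _ (IsFractionRing.injective _ _)]
      exact WittVector.p_nonzero p k
    have h := Matrix.pow_mul_coeff_charpoly_smul (p : L) ((LinearMap.toMatrix b b N).map σ) i
    rw [← LinearMap.toMatrix_mapSemilinear b φ hφ.injective N p hN, LinearMap.charpoly_toMatrix,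
      ← RingEquiv.coe_toRingHom, Matrix.charpoly_map, LinearMap.charpoly_toMatrix, coeff_map,
      Fintype.card_fin, hd] at h
    refine WittVector.eq_zero_of_eq_pow_mul_map_frobenius (σ := (σ : L →+* L)) hσ
      d.add_one_ne_zero (mul_right_cancel₀ (pow_ne_zero i hp) ?_)
    rw [h]
    ring
  · rw [if_pos rfl, ← N.charpoly_natDegree, coeff_natDegree, N.charpoly_monic]
  · rw [if_neg hi.ne', coeff_eq_zero_of_natDegree_lt (by rwa [N.charpoly_natDegree])]
end

section
/- Let K be a field extension of L. Consider an exact sequence 0 → M′ →f M →g M″ → 0 of filtered (φ,N)-modules over K, meaning: f is injective, g is surjective, ker g = range f; f and g commute with the operators φ and with the operators N; and for every n ∈ ℤ the induced sequence 0 → F^n M′_K → F^n M_K → F^n M″_K → 0 is exact. If M′ and M″ are admissible, then M is admissible. -/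
open scoped TensorProduct

/-- The Hodge number `t_H(V,F) = ∑_{n ∈ ℤ} n · dim_K (F^n / F^{n+1})` of a filtered
vector space. -/
noncomputable def hodgeNumber {K V : Type*} [Field K] [AddCommGroup V] [Module K V]
    (F : ℤ → Submodule K V) : ℤ :=
  ∑ᶠ n : ℤ, n * (Module.finrank K (↥(F n) ⧸ Submodule.comap (F n).subtype (F (n + 1))) : ℤ)

/-- The Newton number `t_N(M,φ) = v (det A)`, where `A` is the matrix of the `σ`-semilinear
endomorphism `φ` in a basis of `M` (this value is independent of the chosen basis). -/
noncomputable def newtonNumber {L : Type*} [Field L] {σ : L →+* L} (v : L → ℤ)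
    {M : Type*} [AddCommGroup M] [Module L M] [FiniteDimensional L M]
    (φ : M →ₛₗ[σ] M) : ℤ :=
  v (Matrix.det (Matrix.of fun i j =>
    (Module.finBasis L M).repr (φ (Module.finBasis L M i)) j))

/-- A filtered `(φ,N)`-module `(M, φ, N, F)` (with `F` a filtration on `M_K = K ⊗[L] M`) is
admissible if `t_N(M) = t_H(M)` and `t_N(D) ≥ t_H(D)` for every `φ`- and `N`-stable
`L`-subspace `D ⊆ M`, with the induced structure. -/
def IsAdmissible {L : Type*} [Field L] {σ : L →+* L} (v : L → ℤ)
    (K : Type*) [Field K] [Algebra L K]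
    {M : Type*} [AddCommGroup M] [Module L M] [FiniteDimensional L M]
    (φ : M →ₛₗ[σ] M) (N : M →ₗ[L] M)
    (F : ℤ → Submodule K (K ⊗[L] M)) : Prop :=
  newtonNumber v φ = hodgeNumber F ∧
  ∀ (D : Submodule L M) (hD : ∀ x ∈ D, φ x ∈ D), (∀ x ∈ D, N x ∈ D) →
    hodgeNumber (fun n => Submodule.comap (LinearMap.baseChange K D.subtype) (F n)) ≤
      newtonNumber v (LinearMap.codRestrict D (φ.domRestrict D) (fun c => hD c c.2))

section Hodge

variable {K V V' V'' : Type*} [Field K] [AddCommGroup V] [Module K V]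
  [AddCommGroup V'] [Module K V'] [AddCommGroup V''] [Module K V'']

/-- A decreasing, exhaustive and separated filtration of finite length. -/
structure IsFiniteFiltration (F : ℤ → Submodule K V) : Prop where
  succ_le : ∀ n : ℤ, F (n + 1) ≤ F n
  eq_top : ∃ a : ℤ, ∀ n : ℤ, n ≤ a → F n = ⊤
  eq_bot : ∃ b : ℤ, ∀ n : ℤ, b ≤ n → F n = ⊥

theorem IsFiniteFiltration.comap {F : ℤ → Submodule K V} (hF : IsFiniteFiltration F)
    {f : V' →ₗ[K] V} (hf : Function.Injective f) :
    IsFiniteFiltration fun n => (F n).comap f where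
  succ_le n := Submodule.comap_mono (hF.succ_le n)
  eq_top := by
    obtain ⟨a, ha⟩ := hF.eq_top
    exact ⟨a, fun n hn => by simp [ha n hn]⟩
  eq_bot := by
    obtain ⟨b, hb⟩ := hF.eq_bot
    exact ⟨b, fun n hn => by simp [hb n hn, LinearMap.ker_eq_bot.mpr hf]⟩

theorem IsFiniteFiltration.map {F : ℤ → Submodule K V} (hF : IsFiniteFiltration F)
    {g : V →ₗ[K] V''} (hg : Function.Surjective g) :
    IsFiniteFiltration fun n => (F n).map g where
  succ_le n := Submodule.map_mono (hF.succ_le n)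
  eq_top := by
    obtain ⟨a, ha⟩ := hF.eq_top
    exact ⟨a, fun n hn => by simp [ha n hn, LinearMap.range_eq_top.mpr hg]⟩
  eq_bot := by
    obtain ⟨b, hb⟩ := hF.eq_bot
    exact ⟨b, fun n hn => by simp [hb n hn]⟩

theorem hodgeNumber_eq_sum [FiniteDimensional K V] {F : ℤ → Submodule K V}
    (hF : ∀ n : ℤ, F (n + 1) ≤ F n) {a : ℤ} {m : ℕ} (ha : ∀ n : ℤ, n ≤ a → F n = ⊤)
    (hb : ∀ n : ℤ, a + m ≤ n → F n = ⊥) :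
    hodgeNumber F = a * Module.finrank K V +
      ∑ i ∈ Finset.range m, (Module.finrank K (F (a + (i + 1 : ℕ))) : ℤ) := by
  have hterm (n : ℤ) :
      (Module.finrank K (↥(F n) ⧸ Submodule.comap (F n).subtype (F (n + 1))) : ℤ) =
        Module.finrank K (F n) - Module.finrank K (F (n + 1)) := by
    have h := Submodule.finrank_quotient_add_finrank (Submodule.comap (F n).subtype (F (n + 1)))
    have h' := (Submodule.comapSubtypeEquivOfLe (hF n)).finrank_eq
    omega
  have hsum : ∀ m : ℕ, ∑ i ∈ Finset.range m, (a + i) *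
      ((Module.finrank K (F (a + (i : ℕ))) : ℤ) - Module.finrank K (F (a + (i + 1 : ℕ)))) =
      a * Module.finrank K (F (a + (0 : ℕ))) +
        ∑ i ∈ Finset.range m, (Module.finrank K (F (a + (i + 1 : ℕ))) : ℤ) -
        (a + m) * Module.finrank K (F (a + m)) := by
    intro m
    induction m with
    | zero => simp
    | succ m ih =>
      rw [Finset.sum_range_succ, Finset.sum_range_succ, ih]
      push_cast
      ring
  have hsub : Function.support (fun n : ℤ => n *
      (Module.finrank K (↥(F n) ⧸ Submodule.comap (F n).subtype (F (n + 1))) : ℤ)) ⊆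
      ((Finset.range m).image fun i : ℕ => a + (i : ℤ) : Finset ℤ) := by
    intro n hn
    rw [Function.mem_support, hterm] at hn
    have h1 : a ≤ n := by
      by_contra! h
      exact hn (by rw [ha n (by omega), ha (n + 1) (by omega)]; simp)
    have h2 : n < a + m := by
      by_contra! h
      exact hn (by rw [hb n (by omega), hb (n + 1) (by omega)]; simp)
    simp only [Finset.coe_image, Finset.coe_range, Set.mem_image, Set.mem_Iio]
    exact ⟨(n - a).toNat, by omega, by omega⟩
  have htop : Module.finrank K (F (a + (0 : ℕ))) = Module.finrank K V := by
    rw [ha _ (by simp)]; exact finrank_top K V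
  have hbot : Module.finrank K (F (a + m)) = 0 := by
    rw [hb _ le_rfl]; exact finrank_bot K V
  have := hsum m
  rw [htop, hbot] at this
  rw [hodgeNumber, finsum_eq_sum_of_support_subset _ hsub,
    Finset.sum_image (by intro i _ j _ h; simpa using h)]
  obtain ⟨r, hr⟩ : ∃ r : ℤ → ℤ, ∀ n, (Module.finrank K (F n) : ℤ) = r n := ⟨_, fun _ => rfl⟩
  simp only [hr] at this
  simp only [hterm, hr]
  simpa [add_assoc] using this

/-- A range of degrees outside of which two finite filtrations are both constant. -/
theorem IsFiniteFiltration.exists_common_bounds {F : ℤ → Submodule K V} {G : ℤ → Submodule K V'}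
    (hF : IsFiniteFiltration F) (hG : IsFiniteFiltration G) :
    ∃ (a : ℤ) (m : ℕ), (∀ n : ℤ, n ≤ a → F n = ⊤) ∧ (∀ n : ℤ, a + m ≤ n → F n = ⊥) ∧
      (∀ n : ℤ, n ≤ a → G n = ⊤) ∧ (∀ n : ℤ, a + m ≤ n → G n = ⊥) := by
  obtain ⟨a₁, ha₁⟩ := hF.eq_top
  obtain ⟨a₂, ha₂⟩ := hG.eq_top
  obtain ⟨b₁, hb₁⟩ := hF.eq_bot
  obtain ⟨b₂, hb₂⟩ := hG.eq_bot
  refine ⟨min a₁ a₂, (max b₁ b₂ - min a₁ a₂).toNat, fun n hn => ha₁ n ?_, fun n hn => hb₁ n ?_,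
    fun n hn => ha₂ n ?_, fun n hn => hb₂ n ?_⟩ <;> omega

theorem hodgeNumber_mono [FiniteDimensional K V] {F G : ℤ → Submodule K V}
    (hF : IsFiniteFiltration F) (hG : IsFiniteFiltration G) (hFG : ∀ n, F n ≤ G n) :
    hodgeNumber F ≤ hodgeNumber G := by
  obtain ⟨a, m, h₁, h₂, h₃, h₄⟩ := hF.exists_common_bounds hG
  rw [hodgeNumber_eq_sum hF.succ_le h₁ h₂, hodgeNumber_eq_sum hG.succ_le h₃ h₄]
  gcongr with i _
  exact Submodule.finrank_mono (hFG _)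

theorem Submodule.finrank_comap_add_finrank_map [FiniteDimensional K V]
    {f : V' →ₗ[K] V} {g : V →ₗ[K] V''} (hf : Function.Injective f)
    (hfg : LinearMap.ker g = LinearMap.range f) (P : Submodule K V) :
    Module.finrank K (P.comap f) + Module.finrank K (P.map g) = Module.finrank K P := by
  have h := LinearMap.finrank_range_add_finrank_ker (g.domRestrict P)
  have h₁ : LinearMap.range (g.domRestrict P) = P.map g := LinearMap.range_domRestrict P g
  have h₂ : (LinearMap.ker (g.domRestrict P)).map P.subtype = (P.comap f).map f := by
    rw [Submodule.map_comap_eq, ← hfg]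
    ext x
    simp [and_comm]
  rw [h₁] at h
  have h₃ := (Submodule.equivMapOfInjective P.subtype P.injective_subtype
    (LinearMap.ker (g.domRestrict P))).finrank_eq
  have h₄ := (Submodule.equivMapOfInjective f hf (P.comap f)).finrank_eq
  rw [h₂] at h₃
  omega

theorem hodgeNumber_eq_comap_add_map [FiniteDimensional K V] [FiniteDimensional K V']
    [FiniteDimensional K V''] {f : V' →ₗ[K] V} {g : V →ₗ[K] V''} (hf : Function.Injective f)
    (hg : Function.Surjective g) (hfg : LinearMap.ker g = LinearMap.range f)
    {F : ℤ → Submodule K V} (hF : IsFiniteFiltration F) :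
    hodgeNumber F =
      hodgeNumber (fun n => (F n).comap f) + hodgeNumber (fun n => (F n).map g) := by
  obtain ⟨a, m, h₁, h₂, -, -⟩ := hF.exists_common_bounds hF
  have hd := Submodule.finrank_comap_add_finrank_map hf hfg ⊤
  rw [Submodule.comap_top, Submodule.map_top, LinearMap.range_eq_top.mpr hg, finrank_top,
    finrank_top, finrank_top] at hd
  rw [hodgeNumber_eq_sum hF.succ_le h₁ h₂,
    hodgeNumber_eq_sum (hF.comap hf).succ_le (a := a) (m := m)
      (fun n hn => by simp [h₁ n hn])
      (fun n hn => by simp [h₂ n hn, LinearMap.ker_eq_bot.mpr hf]),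
    hodgeNumber_eq_sum (hF.map hg).succ_le (a := a) (m := m)
      (fun n hn => by simp [h₁ n hn, LinearMap.range_eq_top.mpr hg])
      (fun n hn => by simp [h₂ n hn])]
  simp only [← Submodule.finrank_comap_add_finrank_map hf hfg (F _), ← hd, Nat.cast_add,
    Finset.sum_add_distrib]
  ring

end Hodge

section Newton

variable {L : Type*} [Field L] {σ : L ≃+* L}

/-- The matrix of a semilinear endomorphism `φ` in a basis, with the coordinates of the images
of the basis vectors as rows. -/
noncomputable def semilinearMatrix {ι M : Type*} [AddCommGroup M] [Module L M]
    (b : Module.Basis ι L M) (φ : M →ₛₗ[(σ : L →+* L)] M) : Matrix ι ι L :=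
  Matrix.of fun i j => b.repr (φ (b i)) j

theorem semilinearMatrix_reindex {ι κ M : Type*} [AddCommGroup M] [Module L M]
    (b : Module.Basis ι L M) (e : ι ≃ κ) (φ : M →ₛₗ[(σ : L →+* L)] M) :
    semilinearMatrix (b.reindex e) φ = (semilinearMatrix b φ).submatrix e.symm e.symm := by
  ext i j
  simp [semilinearMatrix]

theorem det_semilinearMatrix_ne_zero {ι M : Type*} [Fintype ι] [DecidableEq ι]
    [AddCommGroup M] [Module L M] (b : Module.Basis ι L M) {φ : M →ₛₗ[(σ : L →+* L)] M}
    (hφ : Function.Injective φ) : (semilinearMatrix b φ).det ≠ 0 := by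
  intro h
  obtain ⟨w, hw, hw0⟩ := Matrix.exists_vecMul_eq_zero_iff.mpr h
  have key : φ (∑ i, σ.symm (w i) • b i) = 0 := by
    apply b.repr.injective
    ext j
    have := congrFun hw0 j
    simpa [semilinearMatrix, Matrix.vecMul, dotProduct, map_sum] using this
  have h0 := hφ (key.trans (map_zero φ).symm)
  have h1 := Fintype.linearIndependent_iff.mp b.linearIndependent _ h0
  exact hw (funext fun i => by simpa using h1 i)

theorem det_toMatrix_mul_det_semilinearMatrix {ι M : Type*} [Fintype ι] [DecidableEq ι]
    [AddCommGroup M] [Module L M] (b c : Module.Basis ι L M) (φ : M →ₛₗ[(σ : L →+* L)] M) :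
    (b.toMatrix c).det * (semilinearMatrix c φ).det =
      σ (b.toMatrix c).det * (semilinearMatrix b φ).det := by
  have h : semilinearMatrix c φ * (b.toMatrix c).transpose =
      (σ.mapMatrix (b.toMatrix c)).transpose * semilinearMatrix b φ := by
    ext i j
    have h1 : ∑ l, c.repr (φ (c i)) l • c l = φ (∑ l, b.repr (c i) l • b l) := by
      rw [c.sum_repr, b.sum_repr]
    have h2 := congrArg (fun x => b.repr x j) h1
    simp only [map_sum, LinearMap.map_smulₛₗ, map_smul, Finsupp.coe_finsetSum, Finset.sum_apply,
      Finsupp.smul_apply, smul_eq_mul] at h2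
    rw [Matrix.mul_apply, Matrix.mul_apply]
    exact h2
  have := congrArg Matrix.det h
  rw [Matrix.det_mul, Matrix.det_mul, Matrix.det_transpose, Matrix.det_transpose] at this
  rw [mul_comm, this, ← RingEquiv.map_det]

theorem newtonNumber_eq_det {v : L → ℤ}
    (hv_mul : ∀ x y : L, x ≠ 0 → y ≠ 0 → v (x * y) = v x + v y) (hv_σ : ∀ x : L, v (σ x) = v x)
    {ι M : Type*} [Fintype ι] [DecidableEq ι] [AddCommGroup M]
    [Module L M] [FiniteDimensional L M] (b : Module.Basis ι L M)
    {φ : M →ₛₗ[(σ : L →+* L)] M} (hφ : Function.Injective φ) :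
    newtonNumber v φ = v (semilinearMatrix b φ).det := by
  let e : Fin (Module.finrank L M) ≃ ι := (Module.finBasis L M).indexEquiv b
  let c := (Module.finBasis L M).reindex e
  have hc : newtonNumber v φ = v (semilinearMatrix c φ).det := by
    rw [semilinearMatrix_reindex, Matrix.det_submatrix_equiv_self]
    rfl
  have hP : (b.toMatrix c).det ≠ 0 := by
    intro h0
    have := congrArg Matrix.det (b.toMatrix_mul_toMatrix_flip c)
    rw [Matrix.det_mul, h0] at this
    simp at this
  have h := congrArg v (det_toMatrix_mul_det_semilinearMatrix b c φ)
  rw [hv_mul _ _ hP (det_semilinearMatrix_ne_zero c hφ),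
    hv_mul _ _ (by simpa using hP) (det_semilinearMatrix_ne_zero b hφ), hv_σ] at h
  omega

theorem newtonNumber_eq_add {v : L → ℤ}
    (hv_mul : ∀ x y : L, x ≠ 0 → y ≠ 0 → v (x * y) = v x + v y) (hv_σ : ∀ x : L, v (σ x) = v x)
    {M' M M'' : Type*}
    [AddCommGroup M'] [Module L M'] [FiniteDimensional L M']
    [AddCommGroup M] [Module L M] [FiniteDimensional L M]
    [AddCommGroup M''] [Module L M''] [FiniteDimensional L M'']
    {φ' : M' →ₛₗ[(σ : L →+* L)] M'} {φ : M →ₛₗ[(σ : L →+* L)] M}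
    {φ'' : M'' →ₛₗ[(σ : L →+* L)] M''}
    (hφ' : Function.Injective φ') (hφ : Function.Injective φ) (hφ'' : Function.Injective φ'')
    {f : M' →ₗ[L] M} {g : M →ₗ[L] M''}
    (hf : Function.Injective f) (hg : Function.Surjective g)
    (hfg : LinearMap.ker g = LinearMap.range f)
    (hfφ : ∀ x : M', f (φ' x) = φ (f x)) (hgφ : ∀ x : M, g (φ x) = φ'' (g x)) :
    newtonNumber v φ = newtonNumber v φ' + newtonNumber v φ'' := by
  obtain ⟨s, hs⟩ := g.exists_rightInverse_of_surjective (LinearMap.range_eq_top.mpr hg)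
  have hgs (x : M'') : g (s x) = x := LinearMap.congr_fun hs x
  have hgf (x : M') : g (f x) = 0 := by
    rw [← LinearMap.mem_ker, hfg]
    exact ⟨x, rfl⟩
  have hbij : Function.Bijective (f.coprod s) := by
    constructor
    · rw [← LinearMap.ker_eq_bot, LinearMap.ker_eq_bot']
      rintro ⟨x, y⟩ hxy
      rw [LinearMap.coprod_apply] at hxy
      have hy : y = 0 := by simpa [hgf, hgs] using congrArg g hxy
      subst hy
      have hx : x = 0 := hf (by simpa using hxy)
      rw [hx]
      rfl
    · intro z
      have : z - s (g z) ∈ LinearMap.range f := by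
        rw [← hfg, LinearMap.mem_ker, map_sub, hgs, sub_self]
      obtain ⟨x, hx⟩ := this
      exact ⟨(x, g z), by simp [hx]⟩
  let e := LinearEquiv.ofBijective (f.coprod s) hbij
  have he (x : M') (y : M'') : e (x, y) = f x + s y := rfl
  have he_fst (x : M') : e.symm (f x) = (x, 0) := by
    rw [e.symm_apply_eq, he, map_zero, add_zero]
  have he_snd (z : M) : (e.symm z).2 = g z := by
    obtain ⟨⟨x, y⟩, rfl⟩ := e.surjective z
    rw [e.symm_apply_apply, he, map_add, hgf, hgs, zero_add]
  let b' := Module.finBasis L M'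
  let b'' := Module.finBasis L M''
  let b := (b'.prod b'').map e
  have hb₁ (i) : b (Sum.inl i) = f (b' i) := by simp [b, he]
  have hb₂ (i) : b (Sum.inr i) = s (b'' i) := by simp [b, he]
  have hrepr₁ (z j) : b.repr z (Sum.inl j) = b'.repr (e.symm z).1 j := by simp [b]
  have hrepr₂ (z j) : b.repr z (Sum.inr j) = b''.repr (g z) j := by simp [b, he_snd]
  have hmat : semilinearMatrix b φ = Matrix.fromBlocks (semilinearMatrix b' φ') 0
      (Matrix.of fun i j => b.repr (φ (s (b'' i))) (Sum.inl j)) (semilinearMatrix b'' φ'') := by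
    ext (i | i) (j | j)
    · simp [semilinearMatrix, hb₁, hrepr₁, ← hfφ, he_fst]
    · simp [semilinearMatrix, hb₁, hrepr₂, ← hfφ, hgf]
    · simp [semilinearMatrix, hb₂]
    · simp [semilinearMatrix, hb₂, hrepr₂, hgφ, hgs]
  rw [newtonNumber_eq_det hv_mul hv_σ b hφ, newtonNumber_eq_det hv_mul hv_σ b' hφ',
    newtonNumber_eq_det hv_mul hv_σ b'' hφ'', hmat, Matrix.det_fromBlocks_zero₁₂,
    hv_mul _ _ (det_semilinearMatrix_ne_zero b' hφ') (det_semilinearMatrix_ne_zero b'' hφ'')]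

end Newton

section BaseChange

variable {L K M' M M'' : Type*} [Field L] [Field K] [Algebra L K]
  [AddCommGroup M'] [Module L M'] [AddCommGroup M] [Module L M] [AddCommGroup M''] [Module L M'']

theorem LinearMap.baseChange_injective {f : M' →ₗ[L] M} (hf : Function.Injective f) :
    Function.Injective (f.baseChange K) :=
  Module.Flat.lTensor_preserves_injective_linearMap f hf

theorem LinearMap.ker_baseChange_eq_range {f : M' →ₗ[L] M} {g : M →ₗ[L] M''}
    (hg : Function.Surjective g) (hfg : LinearMap.ker g = LinearMap.range f) :
    LinearMap.ker (g.baseChange K) = LinearMap.range (f.baseChange K) := by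
  have h : Function.Exact (f.lTensor K) (g.lTensor K) :=
    lTensor_exact K (LinearMap.exact_iff.mpr hfg) hg
  ext x
  exact h x

end BaseChange

/-- In the Witt-vector setting (`L = Frac(W(k))`, `σ` the Frobenius
automorphism, `v = v_p`) and for a field extension `K` of `L`, consider an exact sequence
`0 → M′ → M → M″ → 0` of filtered `(φ,N)`-modules over `K` (the maps commute with the `φ`'s
and the `N`'s, and for each `n` the induced sequence `0 → F^n M′_K → F^n M_K → F^n M″_K → 0`
is exact).  If `M′` and `M″` are admissible, then `M` is admissible. -/
theorem statement9 (p : ℕ) [Fact p.Prime]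
    (k : Type*) [Field k] [CharP k p] [PerfectField k]
    (L : Type*) [Field L] [Algebra (WittVector p k) L] [IsFractionRing (WittVector p k) L]
    (σ : L ≃+* L)
    (hσ : ∀ x : WittVector p k,
      σ (algebraMap (WittVector p k) L x) = algebraMap (WittVector p k) L (WittVector.frobenius x))
    (v : L → ℤ)
    (hv_mul : ∀ x y : L, x ≠ 0 → y ≠ 0 → v (x * y) = v x + v y)
    (hv_p : v ((p : L)) = 1)
    (hv_σ : ∀ x : L, v (σ x) = v x)
    (K : Type*) [Field K] [Algebra L K]
    (M' M M'' : Type*)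
    [AddCommGroup M'] [Module L M'] [FiniteDimensional L M']
    [AddCommGroup M] [Module L M] [FiniteDimensional L M]
    [AddCommGroup M''] [Module L M''] [FiniteDimensional L M'']
    (φ' : M' →ₛₗ[(σ : L →+* L)] M') (φ : M →ₛₗ[(σ : L →+* L)] M)
    (φ'' : M'' →ₛₗ[(σ : L →+* L)] M'')
    (hφ' : Function.Bijective φ') (hφ : Function.Bijective φ) (hφ'' : Function.Bijective φ'')
    (N' : M' →ₗ[L] M') (N : M →ₗ[L] M) (N'' : M'' →ₗ[L] M'')
    (hN'φ' : ∀ x : M', N' (φ' x) = (p : L) • φ' (N' x))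
    (hNφ : ∀ x : M, N (φ x) = (p : L) • φ (N x))
    (hN''φ'' : ∀ x : M'', N'' (φ'' x) = (p : L) • φ'' (N'' x))
    (F' : ℤ → Submodule K (K ⊗[L] M')) (F : ℤ → Submodule K (K ⊗[L] M))
    (F'' : ℤ → Submodule K (K ⊗[L] M''))
    (hF'_mono : ∀ n : ℤ, F' (n + 1) ≤ F' n)
    (hF_mono : ∀ n : ℤ, F (n + 1) ≤ F n)
    (hF''_mono : ∀ n : ℤ, F'' (n + 1) ≤ F'' n)
    (hF'_top : ∃ a : ℤ, ∀ n : ℤ, n ≤ a → F' n = ⊤)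
    (hF_top : ∃ a : ℤ, ∀ n : ℤ, n ≤ a → F n = ⊤)
    (hF''_top : ∃ a : ℤ, ∀ n : ℤ, n ≤ a → F'' n = ⊤)
    (hF'_bot : ∃ b : ℤ, ∀ n : ℤ, b ≤ n → F' n = ⊥)
    (hF_bot : ∃ b : ℤ, ∀ n : ℤ, b ≤ n → F n = ⊥)
    (hF''_bot : ∃ b : ℤ, ∀ n : ℤ, b ≤ n → F'' n = ⊥)
    (f : M' →ₗ[L] M) (g : M →ₗ[L] M'')
    (hf : Function.Injective f) (hg : Function.Surjective g)
    (hfg : LinearMap.ker g = LinearMap.range f)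
    (hfφ : ∀ x : M', f (φ' x) = φ (f x)) (hgφ : ∀ x : M, g (φ x) = φ'' (g x))
    (hfN : ∀ x : M', f (N' x) = N (f x)) (hgN : ∀ x : M, g (N x) = N'' (g x))
    (hcompat : ∀ n : ℤ, Submodule.map (LinearMap.baseChange K f) (F' n) ≤ F n)
    (hexact : ∀ n : ℤ,
      Submodule.map (LinearMap.baseChange K g) (F n) = F'' n ∧
      F n ⊓ LinearMap.ker (LinearMap.baseChange K g) =
        Submodule.map (LinearMap.baseChange K f) (F' n))
    (hM' : IsAdmissible v K φ' N' F') (hM'' : IsAdmissible v K φ'' N'' F'') :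
    IsAdmissible v K φ N F := by
  have hfK := LinearMap.baseChange_injective (K := K) hf
  have hfgK := LinearMap.ker_baseChange_eq_range (K := K) hg hfg
  have hgK := LinearMap.baseChange_surjective (A := K) hg
  have hF : IsFiniteFiltration F := ⟨hF_mono, hF_top, hF_bot⟩
  have hF'' : IsFiniteFiltration F'' := ⟨hF''_mono, hF''_top, hF''_bot⟩
  have hF'_eq (n : ℤ) : (F n).comap (f.baseChange K) = F' n := by
    apply Submodule.map_injective_of_injective hfK
    rw [← (hexact n).2, Submodule.map_comap_eq, hfgK, inf_comm]
  have hF''_eq (n : ℤ) : (F n).map (g.baseChange K) = F'' n := (hexact n).1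
  refine ⟨?_, fun D hDφ hDN => ?_⟩
  · rw [newtonNumber_eq_add hv_mul hv_σ hφ'.1 hφ.1 hφ''.1 hf hg hfg hfφ hgφ,
      hodgeNumber_eq_comap_add_map hfK hgK hfgK hF, hM'.1, hM''.1]
    simp only [hF'_eq, hF''_eq]
  · have hD'φ : ∀ x ∈ D.comap f, φ' x ∈ D.comap f := fun x hx => by
      rw [Submodule.mem_comap, hfφ]
      exact hDφ _ hx
    have hD'N : ∀ x ∈ D.comap f, N' x ∈ D.comap f := fun x hx => by
      rw [Submodule.mem_comap, hfN]
      exact hDN _ hx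
    have hD''φ : ∀ x ∈ D.map g, φ'' x ∈ D.map g := by
      rintro _ ⟨x, hx, rfl⟩
      exact ⟨φ x, hDφ x hx, hgφ x⟩
    have hD''N : ∀ x ∈ D.map g, N'' x ∈ D.map g := by
      rintro _ ⟨x, hx, rfl⟩
      exact ⟨N x, hDN x hx, hgN x⟩
    let fD : D.comap f →ₗ[L] D := f.restrict fun _ hx => hx
    let gD : D →ₗ[L] D.map g := g.restrict fun _ hx => Submodule.mem_map_of_mem hx
    have hfD : Function.Injective fD := fun x y h => Subtype.ext (hf (congrArg Subtype.val h))
    have hgD : Function.Surjective gD := by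
      rintro ⟨_, x, hx, rfl⟩
      exact ⟨⟨x, hx⟩, rfl⟩
    have hfgD : LinearMap.ker gD = LinearMap.range fD := by
      ext x
      have hx : (x : M) ∈ LinearMap.ker g ↔ (x : M) ∈ LinearMap.range f := by rw [hfg]
      constructor
      · intro h
        obtain ⟨y, hy⟩ := hx.mp (congrArg Subtype.val h)
        exact ⟨⟨y, by rw [Submodule.mem_comap, hy]; exact x.2⟩, Subtype.ext hy⟩
      · rintro ⟨y, hy⟩
        exact Subtype.ext (hx.mpr ⟨y, congrArg Subtype.val hy⟩)
    have hsub : D.subtype ∘ₗ fD = f ∘ₗ (D.comap f).subtype := rfl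
    have hsub' : (D.map g).subtype ∘ₗ gD = g ∘ₗ D.subtype := rfl
    have hFD := hF.comap (LinearMap.baseChange_injective (K := K) D.injective_subtype)
    have hgDK := LinearMap.baseChange_surjective (A := K) hgD
    have hnewton := newtonNumber_eq_add hv_mul hv_σ
      (φ' := (φ'.domRestrict (D.comap f)).codRestrict (D.comap f) fun c => hD'φ c c.2)
      (φ := (φ.domRestrict D).codRestrict D fun c => hDφ c c.2)
      (φ'' := (φ''.domRestrict (D.map g)).codRestrict (D.map g) fun c => hD''φ c c.2)
      (fun x y h => Subtype.ext (hφ'.1 (congrArg Subtype.val h)))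
      (fun x y h => Subtype.ext (hφ.1 (congrArg Subtype.val h)))
      (fun x y h => Subtype.ext (hφ''.1 (congrArg Subtype.val h)))
      hfD hgD hfgD (fun x => Subtype.ext (hfφ x)) (fun x => Subtype.ext (hgφ x))
    have hcomap (n : ℤ) : ((F n).comap (D.subtype.baseChange K)).comap (fD.baseChange K) =
        (F' n).comap ((D.comap f).subtype.baseChange K) := by
      rw [← hF'_eq, ← Submodule.comap_comp, ← Submodule.comap_comp, ← LinearMap.baseChange_comp,
        ← LinearMap.baseChange_comp, hsub]
    have hmap (n : ℤ) : ((F n).comap (D.subtype.baseChange K)).map (gD.baseChange K) ≤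
        (F'' n).comap ((D.map g).subtype.baseChange K) := by
      rw [← Submodule.map_le_iff_le_comap, ← Submodule.map_comp, ← LinearMap.baseChange_comp,
        hsub', LinearMap.baseChange_comp, Submodule.map_comp, ← hF''_eq]
      exact Submodule.map_mono (Submodule.map_comap_le _ _)
    rw [hnewton, hodgeNumber_eq_comap_add_map (LinearMap.baseChange_injective (K := K) hfD) hgDK
      (LinearMap.ker_baseChange_eq_range hgD hfgD) hFD]
    simp only [hcomap]
    exact add_le_add (hM'.2 _ hD'φ hD'N) ((hodgeNumber_mono (hFD.map hgDK)
      (hF''.comap (LinearMap.baseChange_injective (D.map g).injective_subtype)) hmap).trans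
        (hM''.2 _ hD''φ hD''N))
end

section
/- Let R be a ring and f : B → C a morphism of double complexes of R-modules indexed by ℤ × ℤ. Assume both B and C are bounded above in the second index, i.e. there exists j₀ ∈ ℤ with B^{i,j} = 0 and C^{i,j} = 0 whenever j > j₀. If for every j ∈ ℤ the induced morphism of complexes B^{•,j} → C^{•,j} (the j-th row, with the first differentials) is a quasi-isomorphism, then the induced morphism of direct-sum total complexes Tot^⊕(B) → Tot^⊕(C) is a quasi-isomorphism. -/
open CategoryTheory Limits

namespace HomologicalComplex

universe v u
variable {R : Type u} [Ring R] {ι : Type*} {c : ComplexShape ι}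
  {K L : HomologicalComplex (ModuleCat.{v} R) c} (φ : K ⟶ L)

variable (K) in
lemma exists_iCycles_apply_eq {i j : ι} (hij : c.next i = j)
    (x : K.X i) (hx : K.d i j x = 0) : ∃ z : K.cycles i, K.iCycles i z = x :=
  (ShortComplex.moduleCat_exact_iff _).1
    (ShortComplex.exact_of_f_is_kernel (.mk (K.iCycles i) (K.d i j) (by simp))
      (K.cyclesIsKernel i j hij)) x hx

variable (K) in
lemma homologyπ_apply_eq_zero_iff {i j : ι} (hij : c.prev j = i) (z : K.cycles j) :
    K.homologyπ j z = 0 ↔ ∃ y : K.X i, K.d i j y = K.iCycles j z := by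
  have key : K.homologyπ j z = 0 ↔ ∃ y : K.X i, K.toCycles i j y = z := by
    refine ⟨fun hz ↦ (ShortComplex.moduleCat_exact_iff _).1
      (ShortComplex.exact_of_g_is_cokernel
        (.mk (K.toCycles i j) (K.homologyπ j) (by simp))
        (K.homologyIsCokernel i j hij)) z hz, ?_⟩
    rintro ⟨y, rfl⟩
    rw [← comp_apply, toCycles_comp_homologyπ]
    rfl
  rw [key]
  refine exists_congr fun y ↦ ?_
  rw [← ((ModuleCat.mono_iff_injective (K.iCycles j)).1 inferInstance).eq_iff,
    ← comp_apply, toCycles_i]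

lemma iCycles_cyclesMap_apply {j : ι} (z : K.cycles j) :
    L.iCycles j (cyclesMap φ j z) = φ.f j (K.iCycles j z) := by
  rw [← comp_apply, cyclesMap_i, comp_apply]

lemma homologyMap_homologyπ_apply {j : ι} (z : K.cycles j) :
    homologyMap φ j (K.homologyπ j z) = L.homologyπ j (cyclesMap φ j z) := by
  rw [← comp_apply, homologyπ_naturality, comp_apply]

variable (K) in
lemma d_iCycles_apply {j : ι} (k : ι) (z : K.cycles j) : K.d j k (K.iCycles j z) = 0 := by
  rw [← comp_apply, iCycles_d]
  rfl

lemma mono_homologyMap_iff_modules {i j k : ι} (hi : c.prev j = i) (hk : c.next j = k) :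
    Mono (homologyMap φ j) ↔ ∀ (x : K.X j) (y : L.X i), K.d j k x = 0 →
      φ.f j x = L.d i j y → ∃ x' : K.X i, K.d i j x' = x := by
  rw [ModuleCat.mono_iff_injective, injective_iff_map_eq_zero]
  refine ⟨fun h x y hx hxy ↦ ?_, fun h a ha ↦ ?_⟩
  · obtain ⟨z, rfl⟩ := K.exists_iCycles_apply_eq hk x hx
    rw [← homologyπ_apply_eq_zero_iff K hi]
    apply h
    rw [homologyMap_homologyπ_apply, homologyπ_apply_eq_zero_iff L hi]
    exact ⟨y, by rw [iCycles_cyclesMap_apply, hxy]⟩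
  · obtain ⟨z, rfl⟩ := (ModuleCat.epi_iff_surjective (K.homologyπ j)).1 inferInstance a
    rw [homologyMap_homologyπ_apply, homologyπ_apply_eq_zero_iff L hi] at ha
    obtain ⟨y, hy⟩ := ha
    rw [homologyπ_apply_eq_zero_iff K hi]
    exact h _ y (d_iCycles_apply K k z) (by rw [hy, iCycles_cyclesMap_apply])

lemma epi_homologyMap_iff_modules {i j k : ι} (hi : c.prev j = i) (hk : c.next j = k) :
    Epi (homologyMap φ j) ↔ ∀ y : L.X j, L.d j k y = 0 →
      ∃ (x : K.X j) (y' : L.X i), K.d j k x = 0 ∧ φ.f j x + L.d i j y' = y := by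
  rw [ModuleCat.epi_iff_surjective]
  refine ⟨fun h y hy ↦ ?_, fun h a ↦ ?_⟩
  · obtain ⟨z, rfl⟩ := L.exists_iCycles_apply_eq hk y hy
    obtain ⟨a, ha⟩ := h (L.homologyπ j z)
    obtain ⟨w, rfl⟩ := (ModuleCat.epi_iff_surjective (K.homologyπ j)).1 inferInstance a
    rw [homologyMap_homologyπ_apply, eq_comm, ← sub_eq_zero, ← map_sub,
      homologyπ_apply_eq_zero_iff L hi] at ha
    obtain ⟨y', hy'⟩ := ha
    refine ⟨K.iCycles j w, y', d_iCycles_apply K k w, ?_⟩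
    rw [hy', map_sub, iCycles_cyclesMap_apply]
    abel
  · obtain ⟨z, rfl⟩ := (ModuleCat.epi_iff_surjective (L.homologyπ j)).1 inferInstance a
    obtain ⟨x, y', hx, hxy⟩ := h _ (d_iCycles_apply L k z)
    obtain ⟨w, rfl⟩ := K.exists_iCycles_apply_eq hk x hx
    refine ⟨K.homologyπ j w, ?_⟩
    rw [homologyMap_homologyπ_apply, eq_comm, ← sub_eq_zero, ← map_sub,
      homologyπ_apply_eq_zero_iff L hi]
    refine ⟨y', ?_⟩
    rw [map_sub, iCycles_cyclesMap_apply, ← hxy]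
    abel

end HomologicalComplex

namespace CochainComplex

universe v u
variable {R : Type u} [Ring R] {K L : CochainComplex (ModuleCat.{v} R) ℤ} (φ : K ⟶ L)

/-- A morphism of cochain complexes of modules is a quasi-isomorphism if and only if
its mapping cone is exact, expressed in terms of elements. -/
lemma quasiIso_iff_modules :
    QuasiIso φ ↔ ∀ ⦃i j k l : ℤ⦄, i + 1 = j → j + 1 = k → k + 1 = l →
      ∀ (x : K.X k) (y : L.X j), K.d k l x = 0 → φ.f k x = L.d j k y →
        ∃ (x' : K.X j) (y' : L.X i), K.d j k x' = x ∧ φ.f j x' + L.d i j y' = y := by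
  refine ⟨fun _ i j k l hi hj hk x y hx hxy ↦ ?_, fun h ↦ ⟨fun j ↦ ?_⟩⟩
  · obtain ⟨x₁, rfl⟩ := (HomologicalComplex.mono_homologyMap_iff_modules φ
      (i := j) (j := k) (k := l) (by simp [← hj]) (by simp [hk])).1 inferInstance x y hx hxy
    obtain ⟨x₂, y', hx₂, hy'⟩ := (HomologicalComplex.epi_homologyMap_iff_modules φ
      (i := i) (j := j) (k := k) (by simp [← hi]) (by simp [hj])).1 inferInstance
        (y - φ.f j x₁) (by
          rw [map_sub, ← hxy, sub_eq_zero, ← comp_apply, ← φ.comm,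
            comp_apply])
    refine ⟨x₁ + x₂, y', by rw [map_add, hx₂, add_zero], ?_⟩
    rw [map_add, add_assoc, hy']
    abel
  · rw [quasiIsoAt_iff_isIso_homologyMap]
    have : Mono (HomologicalComplex.homologyMap φ j) := by
      rw [HomologicalComplex.mono_homologyMap_iff_modules φ (i := j - 1) (k := j + 1)
        (by simp) (by simp)]
      intro x y hx hxy
      obtain ⟨x', -, hx', -⟩ := h (sub_add_cancel (j - 1) 1) (sub_add_cancel j 1) rfl x y hx hxy
      exact ⟨x', hx'⟩
    have : Epi (HomologicalComplex.homologyMap φ j) := by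
      rw [HomologicalComplex.epi_homologyMap_iff_modules φ (i := j - 1) (k := j + 1)
        (by simp) (by simp)]
      intro y hy
      exact h (sub_add_cancel j 1) rfl rfl 0 y (by simp) (by rw [hy, map_zero])
    exact isIso_of_mono_of_epi _

end CochainComplex

namespace HomologicalComplex₂

universe v u
variable {R : Type u} [Ring R]
  {K L : HomologicalComplex₂ (ModuleCat.{v} R) (ComplexShape.up ℤ) (ComplexShape.up ℤ)}
  [K.HasTotal (ComplexShape.up ℤ)] [L.HasTotal (ComplexShape.up ℤ)]

variable (K) in
/-- The filtration of the total complex given in degree `n` by the submodules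
generated by the summands `(K.X p).X q` for `m ≤ p`. -/
noncomputable def totalFiltration (n m : ℤ) : Submodule R ((K.total (ComplexShape.up ℤ)).X n) :=
  ⨆ (p : ℤ) (q : ℤ) (h : p + q = n) (_ : m ≤ p),
    LinearMap.range (K.ιTotal (ComplexShape.up ℤ) p q n h).hom

lemma totalFiltration_le_iff {n m : ℤ} {S : Submodule R ((K.total (ComplexShape.up ℤ)).X n)} :
    K.totalFiltration n m ≤ S ↔ ∀ (p q : ℤ) (h : p + q = n), m ≤ p →
      ∀ x : (K.X p).X q, K.ιTotal (ComplexShape.up ℤ) p q n h x ∈ S := by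
  simp only [totalFiltration, iSup_le_iff]
  refine forall₄_congr fun p q h _ ↦ ⟨fun hS x ↦ hS ⟨x, rfl⟩, ?_⟩
  rintro hS _ ⟨x, rfl⟩
  exact hS x

lemma ιTotal_mem_totalFiltration {n m p q : ℤ} (h : p + q = n) (hm : m ≤ p) (x : (K.X p).X q) :
    K.ιTotal (ComplexShape.up ℤ) p q n h x ∈ K.totalFiltration n m :=
  totalFiltration_le_iff.1 le_rfl p q h hm x

variable (K) in
lemma totalFiltration_antitone (n : ℤ) : Antitone (K.totalFiltration n) := fun _ _ hm ↦
  totalFiltration_le_iff.2 fun _ _ h hp x ↦ ιTotal_mem_totalFiltration h (hm.trans hp) x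

lemma totalFiltration_eq_bot {m : ℤ} (hK : ∀ p, m ≤ p → IsZero (K.X p)) (n : ℤ) :
    K.totalFiltration n m = ⊥ := by
  rw [eq_bot_iff, totalFiltration_le_iff]
  intro p q h hp x
  have : IsZero ((K.X p).X q) := (HomologicalComplex.eval _ _ q).map_isZero (hK p hp)
  rw [this.eq_of_src (K.ιTotal (ComplexShape.up ℤ) p q n h) 0]
  exact zero_mem _

lemma exists_mem_totalFiltration {n : ℤ} (x : (K.total (ComplexShape.up ℤ)).X n) :
    ∃ m, x ∈ K.totalFiltration n m := by
  rw [← Submodule.mem_iSup_of_directed _ (K.totalFiltration_antitone n).directed_le]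
  set S := ⨆ m, K.totalFiltration n m
  have hS : ModuleCat.ofHom S.mkQ = 0 := total.hom_ext _ fun p q h ↦ by
    ext y
    exact (Submodule.Quotient.mk_eq_zero S).2
      (le_iSup (K.totalFiltration n) p (ιTotal_mem_totalFiltration h le_rfl y))
  exact (Submodule.Quotient.mk_eq_zero S).1 (LinearMap.congr_fun (ModuleCat.hom_ext_iff.1 hS) x)

variable (K) in
/-- The projection from the total complex to one of its summands. -/
noncomputable def πTotal (p q n : ℤ) : (K.total (ComplexShape.up ℤ)).X n ⟶ (K.X p).X q :=
  K.totalDesc fun p' q' _ ↦ if h : p' = p ∧ q' = q then (K.XXIsoOfEq _ _ _ h.1 h.2).hom else 0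

lemma πTotal_ιTotal_apply_self {p q n : ℤ} (h : p + q = n) (x : (K.X p).X q) :
    K.πTotal p q n (K.ιTotal (ComplexShape.up ℤ) p q n h x) = x := by
  rw [← comp_apply, πTotal, ι_totalDesc]
  simp

lemma πTotal_ιTotal_apply_of_ne {p q n p' q' : ℤ} (h : p' + q' = n) (hp : p' ≠ p)
    (x : (K.X p').X q') :
    K.πTotal p q n (K.ιTotal (ComplexShape.up ℤ) p' q' n h x) = 0 := by
  rw [← comp_apply, πTotal, ι_totalDesc]
  simp [hp]

lemma mem_totalFiltration_add_one {n m q : ℤ} (h : m + q = n)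
    {x : (K.total (ComplexShape.up ℤ)).X n} (hx : x ∈ K.totalFiltration n m)
    (hx' : K.πTotal m q n x = 0) : x ∈ K.totalFiltration n (m + 1) := by
  have key : K.totalFiltration n m ≤ (K.totalFiltration n (m + 1)).comap
      (LinearMap.id - (K.πTotal m q n ≫ K.ιTotal (ComplexShape.up ℤ) m q n h).hom) := by
    rw [totalFiltration_le_iff]
    intro p q' h' hp y
    rw [Submodule.mem_comap]
    change _ - K.ιTotal (ComplexShape.up ℤ) m q n h (K.πTotal m q n _) ∈ _
    obtain rfl | hp := hp.eq_or_lt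
    · obtain rfl : q' = q := by lia
      rw [πTotal_ιTotal_apply_self]
      simp
    · rw [πTotal_ιTotal_apply_of_ne _ hp.ne', map_zero, sub_zero]
      exact ιTotal_mem_totalFiltration _ hp _
  have := key hx
  rw [Submodule.mem_comap] at this
  change _ - K.ιTotal (ComplexShape.up ℤ) m q n h (K.πTotal m q n _) ∈ _ at this
  rwa [hx', map_zero, sub_zero] at this

lemma d_ιTotal_apply {p q n p' q' n' : ℤ} (h : p + q = n) (hp : p + 1 = p') (hq : q + 1 = q')
    (hn : n + 1 = n') (x : (K.X p).X q) :
    (K.total (ComplexShape.up ℤ)).d n n' (K.ιTotal (ComplexShape.up ℤ) p q n h x) =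
      K.ιTotal (ComplexShape.up ℤ) p' q n' (by dsimp; lia) ((K.d p p').f q x) +
      p.negOnePow • K.ιTotal (ComplexShape.up ℤ) p q' n' (by dsimp; lia) ((K.X p).d q q' x) := by
  rw [← comp_apply, total_d, Preadditive.comp_add, ι_D₁, ι_D₂,
    K.d₁_eq _ hp q n' (by dsimp; lia), K.d₂_eq _ p hq n' (by dsimp; lia)]
  simp

lemma map_ιTotal_apply (φ : K ⟶ L) {p q n : ℤ} (h : p + q = n) (x : (K.X p).X q) :
    (total.map φ (ComplexShape.up ℤ)).f n (K.ιTotal (ComplexShape.up ℤ) p q n h x) =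
      L.ιTotal (ComplexShape.up ℤ) p q n h ((φ.f p).f q x) := by
  rw [← comp_apply, ιTotal_map, comp_apply]

lemma d_mem_totalFiltration {n n' m : ℤ} (hn : n + 1 = n')
    {x : (K.total (ComplexShape.up ℤ)).X n} (hx : x ∈ K.totalFiltration n m) :
    (K.total (ComplexShape.up ℤ)).d n n' x ∈ K.totalFiltration n' m := by
  suffices K.totalFiltration n m ≤
      (K.totalFiltration n' m).comap ((K.total (ComplexShape.up ℤ)).d n n').hom from this hx
  rw [totalFiltration_le_iff]
  intro p q h hp y
  rw [Submodule.mem_comap]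
  change (K.total (ComplexShape.up ℤ)).d n n' _ ∈ _
  rw [d_ιTotal_apply h rfl rfl hn, Units.smul_def]
  exact add_mem (ιTotal_mem_totalFiltration _ (by lia) _)
    (zsmul_mem (ιTotal_mem_totalFiltration _ hp _) _)

lemma map_mem_totalFiltration (φ : K ⟶ L) {n m : ℤ}
    {x : (K.total (ComplexShape.up ℤ)).X n} (hx : x ∈ K.totalFiltration n m) :
    (total.map φ (ComplexShape.up ℤ)).f n x ∈ L.totalFiltration n m := by
  suffices K.totalFiltration n m ≤
      (L.totalFiltration n m).comap ((total.map φ (ComplexShape.up ℤ)).f n).hom from this hx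
  rw [totalFiltration_le_iff]
  intro p q h hp y
  rw [Submodule.mem_comap]
  change (total.map φ (ComplexShape.up ℤ)).f n _ ∈ _
  rw [map_ιTotal_apply]
  exact ιTotal_mem_totalFiltration _ hp _

lemma πTotal_map_apply (φ : K ⟶ L) {p q n : ℤ} (h : p + q = n)
    (x : (K.total (ComplexShape.up ℤ)).X n) :
    L.πTotal p q n ((total.map φ (ComplexShape.up ℤ)).f n x) = (φ.f p).f q (K.πTotal p q n x) := by
  rw [← comp_apply, ← comp_apply]
  congr 2
  refine total.hom_ext _ fun p' q' h' ↦ ?_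
  ext y
  simp only [comp_apply]
  rw [map_ιTotal_apply]
  by_cases hp : p' = p
  · obtain rfl := hp
    obtain rfl : q' = q := by dsimp at h'; lia
    rw [πTotal_ιTotal_apply_self, πTotal_ιTotal_apply_self]
  · rw [πTotal_ιTotal_apply_of_ne _ hp, πTotal_ιTotal_apply_of_ne _ hp, map_zero]

lemma πTotal_d_apply {m q q' n n' : ℤ} (h : m + q = n) (hq : q + 1 = q') (hn : n + 1 = n')
    {x : (K.total (ComplexShape.up ℤ)).X n} (hx : x ∈ K.totalFiltration n m) :
    K.πTotal m q' n' ((K.total (ComplexShape.up ℤ)).d n n' x) =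
      m.negOnePow • (K.X m).d q q' (K.πTotal m q n x) := by
  suffices K.totalFiltration n m ≤ LinearMap.eqLocus
      (((K.total (ComplexShape.up ℤ)).d n n' ≫ K.πTotal m q' n').hom)
      ((m.negOnePow • (K.πTotal m q n ≫ (K.X m).d q q')).hom) from this hx
  rw [totalFiltration_le_iff]
  intro p r h' hp y
  rw [LinearMap.mem_eqLocus]
  change K.πTotal m q' n' ((K.total (ComplexShape.up ℤ)).d n n' _) =
    m.negOnePow • (K.X m).d q q' (K.πTotal m q n _)
  rw [d_ιTotal_apply h' rfl rfl hn, map_add, πTotal_ιTotal_apply_of_ne _ (by lia), zero_add,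
    Units.smul_def, map_zsmul, Units.smul_def]
  obtain rfl | hp := hp.eq_or_lt
  · obtain rfl : r = q := by lia
    subst hq
    rw [πTotal_ιTotal_apply_self, πTotal_ιTotal_apply_self]
  · rw [πTotal_ιTotal_apply_of_ne _ hp.ne', πTotal_ιTotal_apply_of_ne _ hp.ne', map_zero, smul_zero,
      smul_zero]

lemma exists_total_of_mem_totalFiltration (φ : K ⟶ L) [∀ p, QuasiIso (φ.f p)] {N m : ℤ}
    (hK : ∀ p, N ≤ p → IsZero (K.X p)) (hL : ∀ p, N ≤ p → IsZero (L.X p)) (hm : m ≤ N)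
    {i j k l : ℤ} (hi : i + 1 = j) (hj : j + 1 = k) (hk : k + 1 = l)
    (x : (K.total (ComplexShape.up ℤ)).X k) (y : (L.total (ComplexShape.up ℤ)).X j)
    (hxm : x ∈ K.totalFiltration k m) (hym : y ∈ L.totalFiltration j m)
    (hx : (K.total (ComplexShape.up ℤ)).d k l x = 0)
    (hxy : (total.map φ (ComplexShape.up ℤ)).f k x = (L.total (ComplexShape.up ℤ)).d j k y) :
    ∃ (x' : (K.total (ComplexShape.up ℤ)).X j) (y' : (L.total (ComplexShape.up ℤ)).X i),
      (K.total (ComplexShape.up ℤ)).d j k x' = x ∧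
        (total.map φ (ComplexShape.up ℤ)).f j x' + (L.total (ComplexShape.up ℤ)).d i j y' = y := by
  induction m, hm using Int.leInductionDown generalizing x y with
  | base =>
    rw [totalFiltration_eq_bot hK, Submodule.mem_bot] at hxm
    rw [totalFiltration_eq_bot hL, Submodule.mem_bot] at hym
    exact ⟨0, 0, by simp [hxm], by simp [hym]⟩
  | pred m hm ih =>
    obtain ⟨m, rfl⟩ : ∃ m', m = m' + 1 := ⟨m - 1, by simp⟩
    rw [add_sub_cancel_right] at hxm hym
    have hε (M : ModuleCat.{v} R) (z : M) : m.negOnePow • m.negOnePow • z = z := by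
      rw [smul_smul, Int.units_mul_self, one_smul]
    have hε' {M M' : ModuleCat.{v} R} (g : M ⟶ M') (z : M) :
        g (m.negOnePow • z) = m.negOnePow • g z := by
      rw [Units.smul_def, Units.smul_def, map_zsmul]
    have ha := πTotal_d_apply (q := k - m) (q' := l - m) (by lia) (by lia) hk hxm
    have hb := πTotal_d_apply (q := j - m) (q' := k - m) (by lia) (by lia) hj hym
    rw [hx, map_zero] at ha
    rw [← hxy, πTotal_map_apply _ (by lia)] at hb
    obtain ⟨a, b, hab, hba⟩ := CochainComplex.quasiIso_iff_modules (φ.f m) |>.1 inferInstance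
      (i := i - m) (j := j - m) (k := k - m) (l := l - m) (by lia) (by lia) (by lia)
      (m.negOnePow • K.πTotal m (k - m) k x) (L.πTotal m (j - m) j y)
      (by rw [hε', ← ha]) (by rw [hε', hb, hε])
    set X := K.ιTotal (ComplexShape.up ℤ) m (j - m) j (by dsimp; lia) a
    set Y := L.ιTotal (ComplexShape.up ℤ) m (i - m) i (by dsimp; lia) (m.negOnePow • b)
    have hX : X ∈ K.totalFiltration j m := ιTotal_mem_totalFiltration _ le_rfl _
    have hY : Y ∈ L.totalFiltration i m := ιTotal_mem_totalFiltration _ le_rfl _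
    have hdX := πTotal_d_apply (q := j - m) (q' := k - m) (by lia) (by lia) hj hX
    have hdY := πTotal_d_apply (q := i - m) (q' := j - m) (by lia) (by lia) hi hY
    rw [πTotal_ιTotal_apply_self] at hdX hdY
    have hφX := πTotal_map_apply φ (p := m) (q := j - m) (by lia) X
    rw [πTotal_ιTotal_apply_self] at hφX
    clear_value X Y
    obtain ⟨x', y', hx', hy'⟩ := ih (x - (K.total (ComplexShape.up ℤ)).d j k X)
      (y - (total.map φ (ComplexShape.up ℤ)).f j X - (L.total (ComplexShape.up ℤ)).d i j Y)
      (mem_totalFiltration_add_one (q := k - m) (by lia)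
        (sub_mem hxm (d_mem_totalFiltration hj hX))
        (by rw [map_sub, hdX, hab, hε, sub_self]))
      (mem_totalFiltration_add_one (q := j - m) (by lia)
        (sub_mem (sub_mem hym (map_mem_totalFiltration φ hX)) (d_mem_totalFiltration hi hY))
        (by rw [map_sub, map_sub, hdY, hφX, hε', hε, ← hba]; abel))
      (by rw [map_sub, hx, ← comp_apply, HomologicalComplex.d_comp_d]; simp)
      (by
        rw [map_sub, map_sub, map_sub, hxy, ← comp_apply, ← comp_apply, ← comp_apply,
          HomologicalComplex.d_comp_d, HomologicalComplex.Hom.comm]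
        simp)
    refine ⟨x' + X, y' + Y, by rw [map_add, hx', sub_add_cancel], ?_⟩
    rw [map_add, map_add, add_add_add_comm, hy']
    abel

end HomologicalComplex₂

/-- acyclic assembly lemma.  Let `R` be a ring and `f : B ⟶ C` a
morphism of double complexes of `R`-modules indexed by `ℤ × ℤ` (encoded as complexes of
complexes, where the outer index is the second index `j`, so that `B.X j` is the `j`-th
row `B^{•,j}` with the first differentials, and the outer differentials are the second
differentials).  Assume `B` and `C` are bounded above in the second index, i.e. there is
`j₀` with `B^{•,j} = 0` and `C^{•,j} = 0` for `j > j₀`.  If for every `j` the morphism of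
rows `B^{•,j} ⟶ C^{•,j}` is a quasi-isomorphism, then the induced morphism of direct-sum
total complexes `Tot^⊕(B) ⟶ Tot^⊕(C)` is a quasi-isomorphism. -/
theorem statement10 (R : Type*) [Ring R]
    (B C : HomologicalComplex₂ (ModuleCat R) (ComplexShape.up ℤ) (ComplexShape.up ℤ))
    (f : B ⟶ C)
    [B.HasTotal (ComplexShape.up ℤ)] [C.HasTotal (ComplexShape.up ℤ)]
    (j₀ : ℤ)
    (hB : ∀ j : ℤ, j₀ < j → IsZero (B.X j))
    (hC : ∀ j : ℤ, j₀ < j → IsZero (C.X j))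
    (hrow : ∀ j : ℤ, QuasiIso (f.f j)) :
    QuasiIso (HomologicalComplex₂.total.map f (ComplexShape.up ℤ)) := by
  rw [CochainComplex.quasiIso_iff_modules]
  intro i j k l hi hj hk x y hx hxy
  obtain ⟨m₁, hm₁⟩ := HomologicalComplex₂.exists_mem_totalFiltration x
  obtain ⟨m₂, hm₂⟩ := HomologicalComplex₂.exists_mem_totalFiltration y
  exact HomologicalComplex₂.exists_total_of_mem_totalFiltration f
    (N := j₀ + 1) (m := min (min m₁ m₂) (j₀ + 1))
    (fun p hp ↦ hB p (by lia)) (fun p hp ↦ hC p (by lia)) (min_le_right _ _) hi hj hk x y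
    (B.totalFiltration_antitone k (by lia) hm₁) (C.totalFiltration_antitone j (by lia) hm₂)
    hx hxy
end
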